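/- arXiv:2110.05440 — 7 statements merged into one kernel-verified Lean document; each statement's English description precedes it below -/
import Mathlib

section
/- Soundness of the recoverability check (Lemma 2): Fix x' ∈ 𝒳 and families of sets X' : ℕ → Set 𝒳 and X : ℕ → Set 𝒳 such that (i) x' ∈ X' 0; (ii) for all t ≤ k, y ∈ X' t, and uH ∈ UH0, f_H y uH ∈ X t; (iii) for all t < k and y ∈ X t, f_R y uR0 ∈ X' (t+1); (iv) for all t ≤ k, X' t ⊆ Xsafe and X t ⊆ Xsafe; and (v) X k ⊆ Xeq. Then x' is recoverable, i.e. x' ∈ Xrec. -/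
variable {𝒳 𝒰R 𝒰H : Type*}

/-- Primed states of the human-first trajectory ζ_H(x', uH, uR):
`trajP fR fH x' uH uR t` is x'_t, where x'_0 = x',
x_t = fH (x'_t) (uH t), and x'_{t+1} = fR (x_t) (uR t). -/
def trajP (fR : 𝒳 → 𝒰R → 𝒳) (fH : 𝒳 → 𝒰H → 𝒳) (x' : 𝒳)
    (uH : ℕ → 𝒰H) (uR : ℕ → 𝒰R) : ℕ → 𝒳
  | 0 => x'
  | t + 1 => fR (fH (trajP fR fH x' uH uR t) (uH t)) (uR t)

/-- The human-first trajectory is safe up to time k. -/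
def SafeUpTo (fR : 𝒳 → 𝒰R → 𝒳) (fH : 𝒳 → 𝒰H → 𝒳) (Xsafe : Set 𝒳)
    (x' : 𝒳) (uH : ℕ → 𝒰H) (uR : ℕ → 𝒰R) (k : ℕ) : Prop :=
  ∀ t ≤ k, trajP fR fH x' uH uR t ∈ Xsafe ∧
    fH (trajP fR fH x' uH uR t) (uH t) ∈ Xsafe

/-- Safe equilibrium states. -/
def Xeq (fR : 𝒳 → 𝒰R → 𝒳) (fH : 𝒳 → 𝒰H → 𝒳) (Xsafe : Set 𝒳)
    (uR0 : 𝒰R) (UH0 : Set 𝒰H) : Set 𝒳 :=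
  {x | x ∈ Xsafe ∧ fR x uR0 = x ∧ ∀ uH ∈ UH0, fH x uH = x}

/-- Recoverable states. -/
def Xrec (fR : 𝒳 → 𝒰R → 𝒳) (fH : 𝒳 → 𝒰H → 𝒳) (Xsafe : Set 𝒳)
    (uR0 : 𝒰R) (UH0 : Set 𝒰H) (k : ℕ) : Set 𝒳 :=
  {x' | ∀ uH : ℕ → 𝒰H, (∀ t, uH t ∈ UH0) →
    SafeUpTo fR fH Xsafe x' uH (fun _ => uR0) k ∧
    fH (trajP fR fH x' uH (fun _ => uR0) k) (uH k) ∈ Xeq fR fH Xsafe uR0 UH0}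

/-- Soundness of the recoverability check (Lemma 2). -/
theorem isRec_sound (fR : 𝒳 → 𝒰R → 𝒳) (fH : 𝒳 → 𝒰H → 𝒳) (Xsafe : Set 𝒳)
    (uR0 : 𝒰R) (UH0 : Set 𝒰H) (k : ℕ)
    (x' : 𝒳) (X' X : ℕ → Set 𝒳)
    (h0 : x' ∈ X' 0)
    (hH : ∀ t ≤ k, ∀ y ∈ X' t, ∀ uH ∈ UH0, fH y uH ∈ X t)
    (hR : ∀ t < k, ∀ y ∈ X t, fR y uR0 ∈ X' (t + 1))
    (hsafe : ∀ t ≤ k, X' t ⊆ Xsafe ∧ X t ⊆ Xsafe)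
    (heq : X k ⊆ Xeq fR fH Xsafe uR0 UH0) :
    x' ∈ Xrec fR fH Xsafe uR0 UH0 k := by
  intro uH huH
  have hmem : ∀ t ≤ k, trajP fR fH x' uH (fun _ => uR0) t ∈ X' t := by
    intro t
    induction t with
    | zero => exact fun _ => h0
    | succ t ih =>
      intro ht
      exact hR t ht _ (hH t (Nat.le_of_lt ht) _ (ih (Nat.le_of_lt ht)) _ (huH t))
  have hmemH : ∀ t ≤ k, fH (trajP fR fH x' uH (fun _ => uR0) t) (uH t) ∈ X t :=
    fun t ht => hH t ht _ (hmem t ht) _ (huH t)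
  exact ⟨fun t ht => ⟨(hsafe t ht).1 (hmem t ht), (hsafe t ht).2 (hmemH t ht)⟩,
    heq (hmemH k le_rfl)⟩
end

section
/- Recoverability implies infinite-horizon safety: If x' ∈ Xrec, then for every sequence uH : ℕ → 𝒰H with uH t ∈ UH0 for all t, the human-first trajectory ζ_H(x', uH, fun _ => uR0) is safe (x'_t ∈ Xsafe and x_t ∈ Xsafe for all t ∈ ℕ), and moreover x_t = x_k and x'_{t+1} = x_k for all t ≥ k. -/
variable {𝒳 𝒰R 𝒰H : Type*}

/-- Recoverability implies infinite-horizon safety. -/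
theorem recoverable_infinite_safe (fR : 𝒳 → 𝒰R → 𝒳) (fH : 𝒳 → 𝒰H → 𝒳)
    (Xsafe : Set 𝒳) (uR0 : 𝒰R) (UH0 : Set 𝒰H) (k : ℕ)
    (x' : 𝒳) (hx' : x' ∈ Xrec fR fH Xsafe uR0 UH0 k)
    (uH : ℕ → 𝒰H) (huH : ∀ t, uH t ∈ UH0) :
    (∀ t, trajP fR fH x' uH (fun _ => uR0) t ∈ Xsafe ∧
      fH (trajP fR fH x' uH (fun _ => uR0) t) (uH t) ∈ Xsafe) ∧
    (∀ t ≥ k,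
      fH (trajP fR fH x' uH (fun _ => uR0) t) (uH t) =
        fH (trajP fR fH x' uH (fun _ => uR0) k) (uH k) ∧
      trajP fR fH x' uH (fun _ => uR0) (t + 1) =
        fH (trajP fR fH x' uH (fun _ => uR0) k) (uH k)) := by
  obtain ⟨hsafe, heq_safe, heqR, heqH⟩ := hx' uH huH
  have hconst : ∀ t ≥ k,
      fH (trajP fR fH x' uH (fun _ => uR0) t) (uH t) =
        fH (trajP fR fH x' uH (fun _ => uR0) k) (uH k) ∧
      trajP fR fH x' uH (fun _ => uR0) (t + 1) =
        fH (trajP fR fH x' uH (fun _ => uR0) k) (uH k) := by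
    intro t ht
    induction t, ht using Nat.le_induction with
    | base => exact ⟨rfl, heqR⟩
    | succ t _ ih =>
      have hH : fH (trajP fR fH x' uH (fun _ => uR0) (t + 1)) (uH (t + 1)) =
          fH (trajP fR fH x' uH (fun _ => uR0) k) (uH k) := by
        rw [ih.2]
        exact heqH _ (huH _)
      refine ⟨hH, ?_⟩
      rw [trajP, hH]
      exact heqR
  refine ⟨fun t => ?_, hconst⟩
  rcases le_or_gt t k with ht | ht
  · exact hsafe t ht
  · obtain ⟨s, rfl⟩ : ∃ s, t = s + 1 := ⟨t - 1, by omega⟩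
    rw [(hconst (s + 1) ht.le).1, (hconst s (by omega)).2]
    exact ⟨heq_safe, heq_safe⟩
end

section
/- One-step preservation of recoverability under backup actions (Lemma 3): If x' ∈ Xrec and uH ∈ UH0, then f_H(x', uH) ∈ Xsafe and f_R(f_H(x', uH), uR0) ∈ Xrec. -/
variable {𝒳 𝒰R 𝒰H : Type*}

/-- Shifting time by one: the trajectory from `x'` under a human sequence starting with `u` is,
after one step, the trajectory from the successor state under the remaining sequences. -/
theorem trajP_cons (fR : 𝒳 → 𝒰R → 𝒳) (fH : 𝒳 → 𝒰H → 𝒳) (x' : 𝒳)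
    (u : 𝒰H) (v : ℕ → 𝒰H) (uR : ℕ → 𝒰R) (t : ℕ) :
    trajP fR fH x' (fun n => Nat.casesOn n u v) uR (t + 1) =
      trajP fR fH (fR (fH x' u) (uR 0)) v (fun n => uR (n + 1)) t := by
  induction t with
  | zero => rfl
  | succ t ih => rw [trajP, ih]; rfl

/-- One-step preservation of recoverability under backup actions (Lemma 3). -/
theorem recoverable_step_backup (fR : 𝒳 → 𝒰R → 𝒳) (fH : 𝒳 → 𝒰H → 𝒳)
    (Xsafe : Set 𝒳) (uR0 : 𝒰R) (UH0 : Set 𝒰H) (k : ℕ)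
    (x' : 𝒳) (hx' : x' ∈ Xrec fR fH Xsafe uR0 UH0 k)
    (uH : 𝒰H) (huH : uH ∈ UH0) :
    fH x' uH ∈ Xsafe ∧ fR (fH x' uH) uR0 ∈ Xrec fR fH Xsafe uR0 UH0 k := by
  refine ⟨((hx' (fun _ => uH) fun _ => huH).1 0 k.zero_le).2, fun v hv => ?_⟩
  obtain ⟨hsafe, heq⟩ := hx' (fun n => Nat.casesOn n uH v) (Nat.rec huH fun n _ => hv n)
  have hshift := trajP_cons fR fH x' uH v (fun _ => uR0)
  have hk : trajP fR fH (fR (fH x' uH) uR0) v (fun _ => uR0) k ∈ Xeq fR fH Xsafe uR0 UH0 := by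
    rw [← hshift, trajP, heq.2.1]
    exact heq
  have hk' : fH (trajP fR fH (fR (fH x' uH) uR0) v (fun _ => uR0) k) (v k) =
      trajP fR fH (fR (fH x' uH) uR0) v (fun _ => uR0) k := hk.2.2 _ (hv k)
  refine ⟨fun t ht => ?_, hk'.symm ▸ hk⟩
  rcases ht.eq_or_lt with rfl | hlt
  · exact ⟨hk.1, hk'.symm ▸ hk.1⟩
  · have h := hsafe (t + 1) hlt
    rwa [hshift] at h
end

section
/- Finite robust objective value implies safety of all robust trajectories: Under Assumption 1, if x' ∈ 𝒳 and uH : ℕ → 𝒰H satisfy J_H(x', uH) > ⊥, then for every sequence uR : ℕ → 𝒰R with uR t ∈ ÛR for all t, the human-first trajectory ζ_H(x', uH, uR) is safe, i.e. x'_t ∈ Xsafe and x_t ∈ Xsafe for all t ∈ ℕ. -/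
variable {𝒳 𝒰R 𝒰H : Type*}

open Filter in
/-- Discounted objective of a human-first trajectory, computed in `EReal`
as the liminf of the partial sums. -/
noncomputable def J (fR : 𝒳 → 𝒰R → 𝒳) (fH : 𝒳 → 𝒰H → 𝒳)
    (rH : 𝒳 → 𝒰H → 𝒳 → EReal) (γ : ℝ)
    (x' : 𝒳) (uH : ℕ → 𝒰H) (uR : ℕ → 𝒰R) : EReal :=
  Filter.atTop.liminf fun n => ∑ t ∈ Finset.range n,
    ((γ ^ t : ℝ) : EReal) *
      rH (trajP fR fH x' uH uR t) (uH t) (fH (trajP fR fH x' uH uR t) (uH t))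

/-- Robust human objective: worst case over anticipated robot action sequences. -/
noncomputable def JH (fR : 𝒳 → 𝒰R → 𝒳) (fH : 𝒳 → 𝒰H → 𝒳)
    (rH : 𝒳 → 𝒰H → 𝒳 → EReal) (γ : ℝ) (URhat : Set 𝒰R)
    (x' : 𝒳) (uH : ℕ → 𝒰H) : EReal :=
  ⨅ uR : {u : ℕ → 𝒰R // ∀ t, u t ∈ URhat}, J fR fH rH γ x' uH uR.val

/-- Human value: best case over human action sequences. -/
noncomputable def JHval (fR : 𝒳 → 𝒰R → 𝒳) (fH : 𝒳 → 𝒰H → 𝒳)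
    (rH : 𝒳 → 𝒰H → 𝒳 → EReal) (γ : ℝ) (URhat : Set 𝒰R) (x' : 𝒳) : EReal :=
  ⨆ uH : ℕ → 𝒰H, JH fR fH rH γ URhat x' uH

theorem EReal.sum_eq_bot_of_mem {ι : Type*} {s : Finset ι} {f : ι → EReal} {i : ι}
    (hi : i ∈ s) (hf : f i = ⊥) : ∑ j ∈ s, f j = ⊥ := by
  classical
  rw [← Finset.add_sum_erase s f hi, hf, EReal.bot_add]

/-- A trajectory collecting reward `⊥` at some time has objective `⊥`. -/
theorem J_eq_bot {fR : 𝒳 → 𝒰R → 𝒳} {fH : 𝒳 → 𝒰H → 𝒳} {rH : 𝒳 → 𝒰H → 𝒳 → EReal}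
    {γ : ℝ} (hγ : 0 < γ) {x' : 𝒳} {uH : ℕ → 𝒰H} {uR : ℕ → 𝒰R} {t : ℕ}
    (ht : rH (trajP fR fH x' uH uR t) (uH t) (fH (trajP fR fH x' uH uR t) (uH t)) = ⊥) :
    J fR fH rH γ x' uH uR = ⊥ := by
  unfold J
  rw [Filter.liminf_congr (v := fun _ => (⊥ : EReal)), Filter.liminf_const]
  filter_upwards [Filter.eventually_gt_atTop t] with n hn
  refine EReal.sum_eq_bot_of_mem (Finset.mem_range.mpr hn) ?_
  rw [ht, EReal.coe_mul_bot_of_pos (pow_pos hγ t)]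

/-- Finite robust objective value implies safety of all robust trajectories. -/
theorem finite_value_implies_safe (fR : 𝒳 → 𝒰R → 𝒳) (fH : 𝒳 → 𝒰H → 𝒳)
    (Xsafe : Set 𝒳) (γ : ℝ) (hγ0 : 0 < γ) (hγ1 : γ < 1) (URhat : Set 𝒰R)
    (rH : 𝒳 → 𝒰H → 𝒳 → EReal)
    (hrtop : ∀ x' u x, rH x' u x < ⊤)
    (hA1 : ∀ x' u x, x' ∉ Xsafe ∨ x ∉ Xsafe → rH x' u x = ⊥)
    (x' : 𝒳) (uH : ℕ → 𝒰H)
    (hJ : JH fR fH rH γ URhat x' uH > ⊥)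
    (uR : ℕ → 𝒰R) (huR : ∀ t, uR t ∈ URhat) :
    ∀ t, trajP fR fH x' uH uR t ∈ Xsafe ∧
      fH (trajP fR fH x' uH uR t) (uH t) ∈ Xsafe := by
  intro t
  by_contra h
  have hJt := J_eq_bot (fR := fR) (uR := uR) hγ0 (hA1 _ (uH t) _ (not_and_or.mp h))
  have hle : JH fR fH rH γ URhat x' uH ≤ J fR fH rH γ x' uH uR :=
    iInf_le (fun u : {u : ℕ → 𝒰R // ∀ t, u t ∈ URhat} => J fR fH rH γ x' uH u.val) ⟨uR, huR⟩
  exact (hJ.trans_le hle).ne' hJt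
end

section
/- One-step decomposition of the discounted objective: Let x' ∈ 𝒳, uH : ℕ → 𝒰H, uR : ℕ → 𝒰R, and set x = f_H(x', uH 0) and x₊' = f_R(x, uR 0). If r₀ := r_H(x', uH 0, x) satisfies ⊥ < r₀ and r₀ < ⊤ (i.e. r₀ is a real number), then J(ζ_H(x', uH, uR)) = r₀ + γ • J(ζ_H(x₊', uH ∘ (·+1), uR ∘ (·+1))) in EReal. -/
variable {𝒳 𝒰R 𝒰H : Type*}

theorem trajP_shift (fR : 𝒳 → 𝒰R → 𝒳) (fH : 𝒳 → 𝒰H → 𝒳) (x' : 𝒳)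
    (uH : ℕ → 𝒰H) (uR : ℕ → 𝒰R) (t : ℕ) :
    trajP fR fH (fR (fH x' (uH 0)) (uR 0)) (fun t => uH (t + 1)) (fun t => uR (t + 1)) t =
      trajP fR fH x' uH uR (t + 1) := by
  induction t with
  | zero => rfl
  | succ t ih => rw [trajP, ih, trajP.eq_2 fR fH x' uH uR (t + 1)]

namespace EReal

theorem coe_mul_sum_of_nonneg {ι : Type*} {c : ℝ} (hc : 0 ≤ c) (s : Finset ι) (f : ι → EReal) :
    (c : EReal) * ∑ i ∈ s, f i = ∑ i ∈ s, (c : EReal) * f i := by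
  classical
  induction s using Finset.induction_on with
  | empty => simp
  | insert a s ha ih =>
    rw [Finset.sum_insert ha, Finset.sum_insert ha,
      left_distrib_of_nonneg_of_ne_top (EReal.coe_nonneg.mpr hc) (coe_ne_top c), ih]

theorem liminf_coe_add {ι : Type*} {f : Filter ι} [f.NeBot] (r : ℝ) (u : ι → EReal) :
    f.liminf (fun i => (r : EReal) + u i) = r + f.liminf u := by
  refine le_antisymm ?_ ?_
  · have h := liminf_add_le (f := f) (u := fun _ => (r : EReal)) (v := u)
      (by simp) (by simp)
    rwa [Filter.limsup_const] at h
  · have h := le_liminf_add (f := f) (u := fun _ => (r : EReal)) (v := u)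
    rwa [Filter.liminf_const] at h

end EReal

/-- One-step decomposition of the discounted objective. -/
theorem J_one_step_decomposition (fR : 𝒳 → 𝒰R → 𝒳) (fH : 𝒳 → 𝒰H → 𝒳)
    (γ : ℝ) (hγ0 : 0 < γ) (hγ1 : γ < 1)
    (rH : 𝒳 → 𝒰H → 𝒳 → EReal)
    (hrtop : ∀ x' u x, rH x' u x < ⊤)
    (x' : 𝒳) (uH : ℕ → 𝒰H) (uR : ℕ → 𝒰R)
    (hbot : ⊥ < rH x' (uH 0) (fH x' (uH 0)))
    (htop : rH x' (uH 0) (fH x' (uH 0)) < ⊤) :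
    J fR fH rH γ x' uH uR =
      rH x' (uH 0) (fH x' (uH 0)) +
        (γ : EReal) * J fR fH rH γ (fR (fH x' (uH 0)) (uR 0))
          (fun t => uH (t + 1)) (fun t => uR (t + 1)) := by
  have hr := EReal.coe_toReal htop.ne hbot.ne'
  rw [J, J, ← EReal.liminf_const_mul_of_nonneg_of_ne_top (EReal.coe_nonneg.mpr hγ0.le)
    (EReal.coe_ne_top γ), ← hr, ← EReal.liminf_coe_add, hr, ← Filter.liminf_nat_add _ 1]
  congr 1
  funext n
  rw [Finset.sum_range_succ', add_comm, EReal.coe_mul_sum_of_nonneg hγ0.le]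
  congr 1
  · simp [trajP]
  · refine Finset.sum_congr rfl fun t _ => ?_
    rw [trajP_shift, ← mul_assoc, ← EReal.coe_mul, pow_succ']
end

section
/- Decomposition of the robust objective under a fixed first robot action: Let x' ∈ 𝒳 and uH : ℕ → 𝒰H, and set x = f_H(x', uH 0) and x₊' = f_R(x, uR0). If r₀ := r_H(x', uH 0, x) satisfies ⊥ < r₀ and r₀ < ⊤, then the infimum of J(ζ_H(x', uH, uR)) over all sequences uR : ℕ → 𝒰R with uR 0 = uR0 and uR (t+1) ∈ ÛR for all t, equals r₀ + γ • J_H(x₊', uH ∘ (·+1)) in EReal. -/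
variable {𝒳 𝒰R 𝒰H : Type*}

/-- The affine map `y ↦ a + c * y` with real `a` and `c > 0`, as an order automorphism of
`EReal`. -/
noncomputable def EReal.affineOrderIso (a c : ℝ) (hc : 0 < c) : EReal ≃o EReal :=
  have hc' : 0 < c⁻¹ := inv_pos.mpr hc
  have mono_fwd : Monotone fun y : EReal => (a : EReal) + (c : EReal) * y := fun _ _ h =>
    add_le_add_right (mul_le_mul_of_nonneg_left h (EReal.coe_nonneg.mpr hc.le)) _
  have mono_inv : Monotone fun y : EReal => ((c⁻¹ : ℝ) : EReal) * (((-a : ℝ) : EReal) + y) :=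
    fun _ _ h => mul_le_mul_of_nonneg_left (add_le_add_right h _) (EReal.coe_nonneg.mpr hc'.le)
  Equiv.toOrderIso
    { toFun := fun y => (a : EReal) + (c : EReal) * y
      invFun := fun y => ((c⁻¹ : ℝ) : EReal) * (((-a : ℝ) : EReal) + y)
      left_inv := fun y => by
        induction y with
        | bot => simp [EReal.coe_mul_bot_of_pos hc, EReal.coe_mul_bot_of_pos hc']
        | top => simp [EReal.coe_mul_top_of_pos hc, EReal.coe_mul_top_of_pos hc', - EReal.coe_neg]
        | coe y =>
          simp only [← EReal.coe_add, ← EReal.coe_mul, EReal.coe_eq_coe_iff]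
          field_simp
          ring
      right_inv := fun y => by
        induction y with
        | bot => simp [EReal.coe_mul_bot_of_pos hc, EReal.coe_mul_bot_of_pos hc']
        | top => simp [EReal.coe_mul_top_of_pos hc, EReal.coe_mul_top_of_pos hc', - EReal.coe_neg]
        | coe y =>
          simp only [← EReal.coe_add, ← EReal.coe_mul, EReal.coe_eq_coe_iff]
          field_simp
          ring }
    mono_fwd mono_inv

theorem EReal.affineOrderIso_apply (a c : ℝ) (hc : 0 < c) (y : EReal) :
    EReal.affineOrderIso a c hc y = (a : EReal) + (c : EReal) * y := rfl

theorem EReal.coe_mul_sum {ι : Type*} (s : Finset ι) (c : ℝ) (hc : 0 ≤ c) (f : ι → EReal) :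
    (c : EReal) * ∑ i ∈ s, f i = ∑ i ∈ s, (c : EReal) * f i := by
  classical
  induction s using Finset.induction_on with
  | empty => simp
  | insert i s hi ih =>
    rw [Finset.sum_insert hi, Finset.sum_insert hi,
      EReal.left_distrib_of_nonneg_of_ne_top (EReal.coe_nonneg.mpr hc) (EReal.coe_ne_top c), ih]

theorem trajP_add_one (fR : 𝒳 → 𝒰R → 𝒳) (fH : 𝒳 → 𝒰H → 𝒳) (x' : 𝒳)
    (uH : ℕ → 𝒰H) (uR : ℕ → 𝒰R) (t : ℕ) :
    trajP fR fH x' uH uR (t + 1) =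
      trajP fR fH (fR (fH x' (uH 0)) (uR 0)) (fun t => uH (t + 1)) (fun t => uR (t + 1)) t := by
  induction t with
  | zero => rfl
  | succ t ih => rw [trajP, ih, trajP]

/-- The discounted objective splits into the first reward and the discounted objective of the
shifted trajectory. -/
theorem J_eq_affineOrderIso (fR : 𝒳 → 𝒰R → 𝒳) (fH : 𝒳 → 𝒰H → 𝒳)
    (rH : 𝒳 → 𝒰H → 𝒳 → EReal) (γ : ℝ) (hγ : 0 < γ) (x' : 𝒳) (uH : ℕ → 𝒰H) (uR : ℕ → 𝒰R)
    (r : ℝ) (hr : rH x' (uH 0) (fH x' (uH 0)) = r) :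
    J fR fH rH γ x' uH uR = EReal.affineOrderIso r γ hγ
      (J fR fH rH γ (fR (fH x' (uH 0)) (uR 0)) (fun t => uH (t + 1)) (fun t => uR (t + 1))) := by
  unfold J
  rw [OrderIso.liminf_apply, ← Filter.liminf_nat_add _ 1]
  congr 1
  funext n
  rw [EReal.affineOrderIso_apply, EReal.coe_mul_sum _ _ hγ.le, Finset.sum_range_succ', add_comm]
  congr 1
  · simp [trajP, hr]
  · refine Finset.sum_congr rfl fun t _ => ?_
    rw [trajP_add_one, ← mul_assoc, ← EReal.coe_mul, pow_succ']

/-- Decomposition of the robust objective under a fixed first robot action. -/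
theorem JH_fixed_first_action_decomposition (fR : 𝒳 → 𝒰R → 𝒳) (fH : 𝒳 → 𝒰H → 𝒳)
    (uR0 : 𝒰R) (γ : ℝ) (hγ0 : 0 < γ) (hγ1 : γ < 1) (URhat : Set 𝒰R)
    (rH : 𝒳 → 𝒰H → 𝒳 → EReal)
    (hrtop : ∀ x' u x, rH x' u x < ⊤)
    (x' : 𝒳) (uH : ℕ → 𝒰H)
    (hbot : ⊥ < rH x' (uH 0) (fH x' (uH 0)))
    (htop : rH x' (uH 0) (fH x' (uH 0)) < ⊤) :
    (⨅ uR : {u : ℕ → 𝒰R // u 0 = uR0 ∧ ∀ t, u (t + 1) ∈ URhat},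
        J fR fH rH γ x' uH uR.val) =
      rH x' (uH 0) (fH x' (uH 0)) +
        (γ : EReal) * JH fR fH rH γ URhat (fR (fH x' (uH 0)) uR0)
          (fun t => uH (t + 1)) := by
  obtain ⟨r, hr⟩ : ∃ r : ℝ, rH x' (uH 0) (fH x' (uH 0)) = r :=
    ⟨_, (EReal.coe_toReal htop.ne hbot.ne').symm⟩
  rw [hr, ← EReal.affineOrderIso_apply r γ hγ0, JH, OrderIso.map_iInf]
  refine le_antisymm (le_iInf fun v => ?_) (le_iInf fun u => ?_)
  · refine iInf_le_of_le ⟨fun t => Nat.casesOn t uR0 v.val, rfl, v.property⟩ ?_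
    rw [J_eq_affineOrderIso fR fH rH γ hγ0 x' uH _ r hr]
    exact le_rfl
  · obtain ⟨u, rfl, hu⟩ := u
    refine iInf_le_of_le ⟨fun t => u (t + 1), hu⟩ ?_
    rw [J_eq_affineOrderIso fR fH rH γ hγ0 x' uH _ r hr]
end

section
/- Recoverable states are invariant states: Under Assumptions 1, 2, 3, the argmax-attainment property of π_H, and the shield property of π_R, every recoverable state is invariant: Xrec ⊆ Xinv. -/
variable {𝒳 𝒰R 𝒰H : Type*}

/-- Invariant states. -/
noncomputable def Xinv (fR : 𝒳 → 𝒰R → 𝒳) (fH : 𝒳 → 𝒰H → 𝒳) (Xsafe : Set 𝒳)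
    (uR0 : 𝒰R) (UH0 : Set 𝒰H) (k : ℕ)
    (rH : 𝒳 → 𝒰H → 𝒳 → EReal) (γ : ℝ) (URhat : Set 𝒰R)
    (πH : 𝒳 → 𝒰H) (πR : 𝒳 → 𝒰R) : Set 𝒳 :=
  {x' | JHval fR fH rH γ URhat x' > ⊥ ∨
    fR (fH x' (πH x')) (πR (fH x' (πH x'))) ∈ Xrec fR fH Xsafe uR0 UH0 k}

/-- The trajectory after one full step is the trajectory restarted from the state reached. -/
theorem trajP_succ_cons (fR : 𝒳 → 𝒰R → 𝒳) (fH : 𝒳 → 𝒰H → 𝒳) (x' : 𝒳)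
    (u : 𝒰H) (uH : ℕ → 𝒰H) (r : 𝒰R) (t : ℕ) :
    trajP fR fH x' (fun n => Nat.casesOn n u uH) (fun _ => r) (t + 1) =
      trajP fR fH (fR (fH x' u) r) uH (fun _ => r) t := by
  induction t with
  | zero => rfl
  | succ t ih => rw [trajP, ih, trajP]

/-- Recoverability is preserved by a human backup action followed by the robot backup action. -/
theorem step_mem_Xrec {fR : 𝒳 → 𝒰R → 𝒳} {fH : 𝒳 → 𝒰H → 𝒳} {Xsafe : Set 𝒳}
    {uR0 : 𝒰R} {UH0 : Set 𝒰H} {k : ℕ} {x' : 𝒳} {u : 𝒰H}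
    (hx : x' ∈ Xrec fR fH Xsafe uR0 UH0 k) (hu : u ∈ UH0) :
    fR (fH x' u) uR0 ∈ Xrec fR fH Xsafe uR0 UH0 k := by
  intro uH huH
  obtain ⟨hsafe, heq⟩ := hx (fun n => Nat.casesOn n u uH) fun t => by
    cases t with
    | zero => exact hu
    | succ t => exact huH t
  have hlast := trajP_succ_cons fR fH x' u uH uR0 k
  rw [trajP, heq.2.1] at hlast
  rw [hlast] at heq
  have hfix := heq.2.2 (uH k) (huH k)
  refine ⟨fun t ht => ?_, by rwa [hfix]⟩
  rcases ht.eq_or_lt with rfl | ht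
  · exact ⟨heq.1, by rw [hfix]; exact heq.1⟩
  · have h := hsafe (t + 1) ht
    rwa [trajP_succ_cons] at h

/-- Recoverable states are invariant states. -/
theorem rec_subset_inv (fR : 𝒳 → 𝒰R → 𝒳) (fH : 𝒳 → 𝒰H → 𝒳) (Xsafe : Set 𝒳)
    (uR0 : 𝒰R) (UH0 : Set 𝒰H) (k : ℕ)
    (γ : ℝ) (hγ0 : 0 < γ) (hγ1 : γ < 1) (URhat : Set 𝒰R)
    (rH : 𝒳 → 𝒰H → 𝒳 → EReal)
    (hrtop : ∀ x' u x, rH x' u x < ⊤)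
    (hA1 : ∀ x' u x, x' ∉ Xsafe ∨ x ∉ Xsafe → rH x' u x = ⊥)
    (hA2 : uR0 ∈ URhat)
    (πH : 𝒳 → 𝒰H)
    (hπHmax : ∀ x' : 𝒳, JHval fR fH rH γ URhat x' > ⊥ →
      ∃ uH : ℕ → 𝒰H, uH 0 = πH x' ∧
        JH fR fH rH γ URhat x' uH = JHval fR fH rH γ URhat x')
    (hA3 : ∀ x' : 𝒳, JHval fR fH rH γ URhat x' = ⊥ → πH x' ∈ UH0)
    (πR : 𝒳 → 𝒰R)
    (hshield : ∀ x : 𝒳, πR x ≠ uR0 → fR x (πR x) ∈ Xrec fR fH Xsafe uR0 UH0 k) :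
    Xrec fR fH Xsafe uR0 UH0 k ⊆
      Xinv fR fH Xsafe uR0 UH0 k rH γ URhat πH πR := by
  intro x' hx
  rcases eq_or_ne (JHval fR fH rH γ URhat x') ⊥ with hJ | hJ
  · right
    by_cases hR : πR (fH x' (πH x')) = uR0
    · rw [hR]
      exact step_mem_Xrec hx (hA3 x' hJ)
    · exact hshield _ hR
  · exact Or.inl (bot_lt_iff_ne_bot.mpr hJ)
end
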